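/- arXiv:2001.04549 — 11 statements merged into one kernel-verified Lean document; each statement's English description precedes it below -/
import Mathlib

section
/- Let A be a finite set and let C be a clone on A. Assume D is a clone on A such that for all n and all T ⊆ A^n, T is the solution set of some system of C-equations if and only if T is closed under D. Then D = C*. -/
/-- A family of finitary operations on `A`, indexed by arity. -/
abbrev OpFamily (A : Type*) := ∀ n : ℕ, Set ((Fin n → A) → A)

/-- `C` is a clone: it contains all projections and is closed under composition. -/
def IsClone {A : Type*} (C : OpFamily A) : Prop :=
  (∀ (n : ℕ) (i : Fin n), (fun x : Fin n → A => x i) ∈ C n) ∧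
  (∀ (n k : ℕ) (f : (Fin n → A) → A) (g : Fin n → (Fin k → A) → A),
    f ∈ C n → (∀ i, g i ∈ C k) → (fun x => f (fun i => g i x)) ∈ C k)

/-- `f` and `g` commute. -/
def Commutes {A : Type*} {n m : ℕ} (f : (Fin n → A) → A) (g : (Fin m → A) → A) : Prop :=
  ∀ M : Fin n → Fin m → A,
    f (fun i => g (M i)) = g (fun j => f (fun i => M i j))

/-- The centralizer `F*` of a family of operations. -/
def Centralizer {A : Type*} (F : OpFamily A) : OpFamily A :=
  fun m => {g | ∀ (n : ℕ) (f : (Fin n → A) → A), f ∈ F n → Commutes f g}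

/-- `T ⊆ A^n` is closed under the family of operations `D`. -/
def ClosedUnder {A : Type*} (D : OpFamily A) {n : ℕ} (T : Set (Fin n → A)) : Prop :=
  ∀ (m : ℕ) (h : (Fin m → A) → A), h ∈ D m →
    ∀ t : Fin m → (Fin n → A), (∀ j, t j ∈ T) →
      (fun i => h (fun j => t j i)) ∈ T

/-- `T` is the solution set of a (finite) system of `C`-equations in `n` variables. -/
def IsSolutionSet {A : Type*} (C : OpFamily A) (n : ℕ) (T : Set (Fin n → A)) : Prop :=
  ∃ (t : ℕ) (f g : Fin t → ((Fin n → A) → A)),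
    (∀ i, f i ∈ C n) ∧ (∀ i, g i ∈ C n) ∧
    T = {a | ∀ i, f i a = g i a}

/-- Property SDC: solution sets of systems of `C`-equations are exactly
the sets closed under the centralizer of `C`. -/
def HasSDC {A : Type*} (C : OpFamily A) : Prop :=
  ∀ (n : ℕ) (T : Set (Fin n → A)),
    IsSolutionSet C n T ↔ ClosedUnder (Centralizer C) T

/-- A family of relations on `A`, indexed by arity. -/
abbrev RelFamily (A : Type*) := ∀ h : ℕ, Set (Set (Fin h → A))

/-- `C∘`: the relations that are solution sets of a single `C`-equation. -/
def SolRels {A : Type*} (C : OpFamily A) : RelFamily A :=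
  fun h => {ρ | ∃ f g, f ∈ C h ∧ g ∈ C h ∧ ρ = {a | f a = g a}}

/-- `C•`: the graphs of the members of `C`. -/
def GraphRels {A : Type*} (C : OpFamily A) : RelFamily A :=
  fun h => {ρ | ∃ (n : ℕ) (e : n + 1 = h) (f : (Fin n → A) → A), f ∈ C n ∧
    ρ = {a | f (fun i => a (Fin.cast e i.castSucc)) = a (Fin.cast e (Fin.last n))}}

/-- `T ∈ ⟨R⟩∃`: `T` is definable by a primitive positive formula over `R ∪ {=}`,
with free variables `x_1,…,x_n` and quantified variables `y_1,…,y_m`. -/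
def PPDef {A : Type*} (R : RelFamily A) (n : ℕ) (T : Set (Fin n → A)) : Prop :=
  ∃ (m t : ℕ) (r : Fin t → ℕ) (ρ : ∀ j, Set (Fin (r j) → A))
    (z : ∀ j, Fin (r j) → Fin (n + m))
    (s : ℕ) (e₁ e₂ : Fin s → Fin (n + m)),
    (∀ j, ρ j ∈ R (r j)) ∧
    T = {x | ∃ y : Fin m → A,
          (∀ j, (fun i => Fin.append x y (z j i)) ∈ ρ j) ∧
          (∀ k, Fin.append x y (e₁ k) = Fin.append x y (e₂ k))}

/-- `T ∈ ⟨R⟩∄`: `T` is definable by a quantifier-free primitive positive formula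
over `R ∪ {=}`. -/
def QFPPDef {A : Type*} (R : RelFamily A) (n : ℕ) (T : Set (Fin n → A)) : Prop :=
  ∃ (t : ℕ) (r : Fin t → ℕ) (ρ : ∀ j, Set (Fin (r j) → A))
    (z : ∀ j, Fin (r j) → Fin n)
    (s : ℕ) (e₁ e₂ : Fin s → Fin n),
    (∀ j, ρ j ∈ R (r j)) ∧
    T = {x | (∀ j, (fun i => x (z j i)) ∈ ρ j) ∧ (∀ k, x (e₁ k) = x (e₂ k))}

/-- `g` preserves the relation `ρ`. -/
def Preserves {A : Type*} {m h : ℕ} (g : (Fin m → A) → A) (ρ : Set (Fin h → A)) : Prop :=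
  ∀ t : Fin m → (Fin h → A), (∀ j, t j ∈ ρ) → (fun i => g (fun j => t j i)) ∈ ρ

/-- `ρ ∈ Inv(F)`: every member of `F` preserves `ρ`. -/
def MemInv {A : Type*} (F : OpFamily A) {h : ℕ} (ρ : Set (Fin h → A)) : Prop :=
  ∀ (m : ℕ) (g : (Fin m → A) → A), g ∈ F m → Preserves g ρ

/-- The clone `[∧, ∨]` generated by the lattice operations: all lattice term operations. -/
inductive LatticeTerm (L : Type*) [Lattice L] : ∀ n : ℕ, ((Fin n → L) → L) → Prop
  | proj {n : ℕ} (i : Fin n) : LatticeTerm L n (fun x => x i)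
  | inf {n : ℕ} {f g : (Fin n → L) → L} :
      LatticeTerm L n f → LatticeTerm L n g → LatticeTerm L n (fun x => f x ⊓ g x)
  | sup {n : ℕ} {f g : (Fin n → L) → L} :
      LatticeTerm L n f → LatticeTerm L n g → LatticeTerm L n (fun x => f x ⊔ g x)

/-- The clone `[∧, ∨]` as an `OpFamily`. -/
def LatticeClone (L : Type*) [Lattice L] : OpFamily L :=
  fun n f => LatticeTerm L n f

/-- The clone `[∧]` generated by the meet operation: all nonempty meets of variables. -/
inductive MeetTerm (M : Type*) [SemilatticeInf M] : ∀ n : ℕ, ((Fin n → M) → M) → Prop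
  | proj {n : ℕ} (i : Fin n) : MeetTerm M n (fun x => x i)
  | inf {n : ℕ} {f g : (Fin n → M) → M} :
      MeetTerm M n f → MeetTerm M n g → MeetTerm M n (fun x => f x ⊓ g x)

/-- The clone `[∧]` as an `OpFamily`. -/
def MeetClone (M : Type*) [SemilatticeInf M] : OpFamily M :=
  fun n f => MeetTerm M n f

/-- If closure under a clone `D` characterizes solution sets of
systems of `C`-equations, then `D = C*`. -/
theorem stmt_1 {A : Type*} [Finite A] (C D : OpFamily A)
    (hC : IsClone C) (hD : IsClone D)
    (h : ∀ (n : ℕ) (T : Set (Fin n → A)),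
      IsSolutionSet C n T ↔ ClosedUnder D T) :
    D = Centralizer C := by
  obtain ⟨projC, compC⟩ := hC
  obtain ⟨projD, compD⟩ := hD
  funext m
  ext g
  constructor
  · intro hg n f hf M
    have hT : IsSolutionSet C (n + 1)
        {a : Fin (n + 1) → A | f (fun i => a i.castSucc) = a (Fin.last n)} := by
      refine ⟨1, fun _ a => f (fun i => a i.castSucc), fun _ a => a (Fin.last n), ?_, ?_, ?_⟩
      · intro _
        exact compC n (n + 1) f (fun i a => a i.castSucc) hf (fun i => projC _ _)
      · intro _
        exact projC _ _
      · ext a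
        simp
    have hcl := (h _ _).1 hT m g hg
      (fun j => Fin.snoc (α := fun _ => A) (fun i => M i j) (f (fun i => M i j)))
      (by intro j; simp)
    simpa using hcl
  · intro hg
    obtain ⟨N, ⟨e⟩⟩ := Finite.exists_equiv_fin (Fin m → A)
    have hcl : ClosedUnder D {t : Fin N → A | ∃ d ∈ D m, t = fun i => d (e.symm i)} := by
      intro k p hp t ht
      choose d hd hdt using ht
      refine ⟨fun x => p (fun j => d j x), compD k m p d hp hd, ?_⟩
      funext i
      simp [hdt]
    obtain ⟨s, f₁, f₂, hf₁, hf₂, hT⟩ := (h _ _).2 hcl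
    have hmem : (fun i => g (e.symm i)) ∈
        {t : Fin N → A | ∃ d ∈ D m, t = fun i => d (e.symm i)} := by
      have hproj : ∀ j : Fin m, (fun i => e.symm i j) ∈
          {t : Fin N → A | ∃ d ∈ D m, t = fun i => d (e.symm i)} :=
        fun j => ⟨fun x => x j, projD m j, rfl⟩
      rw [hT] at hproj ⊢
      intro l
      have h1 := hg _ _ (hf₁ l) (fun i => e.symm i)
      have h2 := hg _ _ (hf₂ l) (fun i => e.symm i)
      rw [h1, h2]
      congr 1
      funext j
      exact hproj j l
    obtain ⟨d, hd, hdg⟩ := hmem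
    have : g = d := by
      funext x
      simpa using congrFun hdg (e x)
    rw [this]
    exact hd
end

section
/- Let A be a finite set and C a clone on A. Then C has Property SDC if and only if ⟨C∘⟩∄ = ⟨C∘⟩∃, i.e., every relation on A definable by a primitive positive formula over C∘ is definable by a quantifier-free primitive positive formula over C∘. -/
theorem qf_iff_sol {A : Type*} (C : OpFamily A) (hC : IsClone C) (n : ℕ)
    (T : Set (Fin n → A)) : QFPPDef (SolRels C) n T ↔ IsSolutionSet C n T := by
  constructor
  · rintro ⟨t, r, ρ, z, s, e₁, e₂, hρ, rfl⟩
    choose f g hf hg hfg using hρ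
    refine ⟨t + s,
      Fin.append (fun j x => f j (fun i => x (z j i))) (fun k x => x (e₁ k)),
      Fin.append (fun j x => g j (fun i => x (z j i))) (fun k x => x (e₂ k)), ?_, ?_, ?_⟩
    · intro i
      refine Fin.addCases (fun j => ?_) (fun k => ?_) i
      · rw [Fin.append_left]
        exact hC.2 _ _ _ (fun i x => x (z j i)) (hf j) (fun i => hC.1 _ _)
      · rw [Fin.append_right]
        exact hC.1 _ _
    · intro i
      refine Fin.addCases (fun j => ?_) (fun k => ?_) i
      · rw [Fin.append_left]
        exact hC.2 _ _ _ (fun i x => x (z j i)) (hg j) (fun i => hC.1 _ _)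
      · rw [Fin.append_right]
        exact hC.1 _ _
    · ext x
      simp only [Set.mem_setOf_eq, hfg]
      constructor
      · rintro ⟨h1, h2⟩ i
        refine Fin.addCases (fun j => ?_) (fun k => ?_) i
        · rw [Fin.append_left, Fin.append_left]
          exact h1 j
        · rw [Fin.append_right, Fin.append_right]
          exact h2 k
      · intro h
        refine ⟨fun j => ?_, fun k => ?_⟩
        · have := h (Fin.castAdd s j)
          rwa [Fin.append_left, Fin.append_left] at this
        · have := h (Fin.natAdd t k)
          rwa [Fin.append_right, Fin.append_right] at this
  · rintro ⟨t, f, g, hf, hg, rfl⟩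
    refine ⟨t, fun _ => n, fun j => {a | f j a = g j a}, fun _ i => i, 0,
      Fin.elim0, Fin.elim0, fun j => ⟨f j, g j, hf j, hg j, rfl⟩, ?_⟩
    ext x
    simp

theorem pp_closed {A : Type*} (C : OpFamily A) (n : ℕ)
    (T : Set (Fin n → A)) (hT : PPDef (SolRels C) n T) :
    ClosedUnder (Centralizer C) T := by
  obtain ⟨m, t, r, ρ, z, s, e₁, e₂, hρ, rfl⟩ := hT
  intro p h hh u hu
  choose y hy1 hy2 using hu
  have key : ∀ l, Fin.append (fun i => h (fun j => u j i)) (fun i => h (fun j => y j i)) l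
      = h (fun j => Fin.append (u j) (y j) l) := by
    intro l
    refine Fin.addCases (fun j => ?_) (fun k => ?_) l
    · simp only [Fin.append_left]
    · simp only [Fin.append_right]
  refine ⟨fun i => h (fun j => y j i), fun j => ?_, fun k => ?_⟩
  · obtain ⟨f, g, hf, hg, hfg⟩ := hρ j
    simp only [key]
    simp only [hfg, Set.mem_setOf_eq] at hy1 ⊢
    have h1 := hh _ f hf (fun i q => Fin.append (u q) (y q) (z j i))
    have h2 := hh _ g hg (fun i q => Fin.append (u q) (y q) (z j i))
    rw [h1, h2]
    congr 1
    funext q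
    have := hy1 q j
    rw [hfg] at this
    exact this
  · rw [key, key]
    congr 1
    funext q
    exact hy2 q k

theorem closed_pp {A : Type*} [Finite A] (C : OpFamily A) (hC : IsClone C) (n : ℕ)
    (T : Set (Fin n → A)) (hT : ClosedUnder (Centralizer C) T) :
    PPDef (SolRels C) n T := by
  obtain ⟨m, ⟨e⟩⟩ := Finite.exists_equiv_fin T
  obtain ⟨N, ⟨d⟩⟩ := Finite.exists_equiv_fin (Fin m → A)
  let P := {p : ((Fin N → A) → A) × ((Fin N → A) → A) //
    p.1 ∈ C N ∧ p.2 ∈ C N ∧ ∀ h ∈ Centralizer C m,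
      p.1 (fun l => h (d.symm l)) = p.2 (fun l => h (d.symm l))}
  have : Finite P := inferInstance
  obtain ⟨t, ⟨c⟩⟩ := Finite.exists_equiv_fin P
  let row : Fin n → Fin m → A := fun i j => (e.symm j).1 i
  refine ⟨N, t, fun _ => N, fun j => {a | (c.symm j).1.1 a = (c.symm j).1.2 a},
    fun _ i => Fin.natAdd n i, n, fun k => Fin.castAdd N k,
    fun k => Fin.natAdd n (d (row k)),
    fun j => ⟨_, _, (c.symm j).2.1, (c.symm j).2.2.1, rfl⟩, ?_⟩
  ext x
  simp only [Fin.append_left, Fin.append_right, Set.mem_setOf_eq]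
  constructor
  · intro hx
    refine ⟨fun l => d.symm l (e ⟨x, hx⟩), fun j => ?_, fun k => ?_⟩
    · exact (c.symm j).2.2.2 (fun v => v (e ⟨x, hx⟩)) (fun _ _ _ _ => rfl)
    · simp [row]
  · rintro ⟨y, hy1, hy2⟩
    have hmem : (fun v => y (d v)) ∈ Centralizer C m := by
      intro k f hf M
      have hp := hy1 (c ⟨(fun a => f (fun i => a (d (M i))),
        fun a => a (d (fun j => f (fun i => M i j)))),
        hC.2 _ _ _ (fun i a => a (d (M i))) hf (fun i => hC.1 _ _), hC.1 _ _,
        fun h hh => by simpa using hh k f hf M⟩)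
      simpa using hp
    have := hT m _ hmem (fun j => (e.symm j).1) (fun j => (e.symm j).2)
    have hx : x = fun i => y (d (fun j => (e.symm j).1 i)) := funext hy2
    rw [hx]
    exact this

/-- `C` has Property SDC iff `⟨C∘⟩∄ = ⟨C∘⟩∃`. -/
theorem stmt_2 {A : Type*} [Finite A] (C : OpFamily A) (hC : IsClone C) :
    HasSDC C ↔
      ∀ (n : ℕ) (T : Set (Fin n → A)),
        QFPPDef (SolRels C) n T ↔ PPDef (SolRels C) n T := by
  have h1 := qf_iff_sol C hC
  have h2 : ∀ (n : ℕ) (T : Set (Fin n → A)),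
      PPDef (SolRels C) n T ↔ ClosedUnder (Centralizer C) T :=
    fun n T => ⟨pp_closed C n T, closed_pp C hC n T⟩
  simp only [h1, h2]
  rfl
end

section
/- Let A be a finite set and C a clone on A. Then Inv(C*) = ⟨C•⟩∃, i.e., a relation on A is preserved by every operation commuting with all members of C if and only if it is definable by a primitive positive formula over the graphs of members of C. Consequently, a set T ⊆ A^n is closed under C* if and only if T ∈ ⟨C∘⟩∃. -/
theorem PPDef.preserved {A : Type*} {R : RelFamily A} {k n : ℕ} (g : (Fin k → A) → A)
    (hR : ∀ (h : ℕ) (ρ : Set (Fin h → A)), ρ ∈ R h → Preserves g ρ)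
    {T : Set (Fin n → A)} (hT : PPDef R n T) : Preserves g T := by
  obtain ⟨m, t, r, ρ, z, s, e₁, e₂, hρ, rfl⟩ := hT
  intro x hx
  choose y hy1 hy2 using hx
  have key : ∀ v : Fin (n + m), Fin.append (fun i => g (fun j => x j i))
      (fun i => g (fun j => y j i)) v = g (fun j => Fin.append (x j) (y j) v) := by
    intro v
    refine Fin.addCases (fun i => ?_) (fun i => ?_) v <;> simp
  refine ⟨fun i => g (fun j => y j i), fun a => ?_, fun a => ?_⟩
  · simp only [key]
    exact hR _ _ (hρ a) (fun j i => Fin.append (x j) (y j) (z a i)) (fun j => hy1 j a)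
  · simp only [key, hy2]

theorem PPDef.mono {A : Type*} {R S : RelFamily A} (hRS : ∀ h, R h ⊆ S h) {n : ℕ}
    {T : Set (Fin n → A)} (hT : PPDef R n T) : PPDef S n T := by
  obtain ⟨m, t, r, ρ, z, s, e₁, e₂, hρ, h⟩ := hT
  exact ⟨m, t, r, ρ, z, s, e₁, e₂, fun j => hRS _ (hρ j), h⟩

theorem graph_subset_sol {A : Type*} (C : OpFamily A) (hC : IsClone C) (h : ℕ) :
    GraphRels C h ⊆ SolRels C h := by
  rintro ρ ⟨n, rfl, f, hf, rfl⟩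
  exact ⟨fun a => f (fun i => a i.castSucc), fun a => a (Fin.last n),
    hC.2 _ _ f (fun i a => a i.castSucc) hf (fun i => hC.1 _ _), hC.1 _ _, rfl⟩

theorem preserves_sol {A : Type*} (C : OpFamily A) {k : ℕ} {g : (Fin k → A) → A}
    (hg : g ∈ Centralizer C k) (h : ℕ) (ρ : Set (Fin h → A)) (hρ : ρ ∈ SolRels C h) :
    Preserves g ρ := by
  obtain ⟨f, f', hf, hf', rfl⟩ := hρ
  intro t ht
  have h1 := hg _ f hf (fun i j => t j i)
  have h2 := hg _ f' hf' (fun i j => t j i)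
  have h3 : ∀ j, f (t j) = f' (t j) := ht
  change f _ = f' _
  rw [h1, h2]
  exact congrArg g (funext h3)

theorem pp_of_closed {A : Type*} [Finite A] (C : OpFamily A) (n : ℕ) (T : Set (Fin n → A))
    (hT : MemInv (Centralizer C) T) : PPDef (GraphRels C) n T := by
  classical
  obtain ⟨k, ⟨eT⟩⟩ := Finite.exists_equiv_fin T
  obtain ⟨m, ⟨eV⟩⟩ := Finite.exists_equiv_fin (Fin k → A)
  obtain ⟨t, ⟨eJ⟩⟩ := Finite.exists_equiv_fin {y : (Fin k → A) → A // y ∉ Centralizer C k}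
  have hbad : ∀ y : {y : (Fin k → A) → A // y ∉ Centralizer C k},
      ∃ (l : ℕ) (f : (Fin l → A) → A) (M : Fin l → Fin k → A), f ∈ C l ∧
        f (fun i => y.1 (M i)) ≠ y.1 (fun j => f (fun i => M i j)) := by
    rintro ⟨y, hy⟩
    by_contra! hcon
    exact hy fun l f hf M => hcon l f M hf
  choose l f M hf hM using hbad
  refine ⟨m, t, fun j => l (eJ.symm j) + 1,
    fun j => {a | f (eJ.symm j) (fun i => a i.castSucc) = a (Fin.last _)},
    fun j => Fin.snoc (α := fun _ => Fin (n + m))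
      (fun i => Fin.natAdd n (eV (M (eJ.symm j) i)))
      (Fin.natAdd n (eV (fun a => f (eJ.symm j) (fun i => M (eJ.symm j) i a)))),
    n, fun i => Fin.castAdd m i, fun i => Fin.natAdd n (eV (fun j => (eT.symm j).1 i)),
    fun j => ⟨_, rfl, f _, hf _, rfl⟩, ?_⟩
  ext x
  simp only [Set.mem_setOf_eq, Fin.snoc_castSucc, Fin.snoc_last, Fin.append_left,
    Fin.append_right]
  constructor
  · intro hx
    refine ⟨fun v => eV.symm v (eT ⟨x, hx⟩), fun j => ?_, fun i => ?_⟩ <;> simp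
  · rintro ⟨y, hy1, hy2⟩
    have hg : (fun v => y (eV v)) ∈ Centralizer C k := by
      by_contra hcon
      have := hy1 (eJ ⟨_, hcon⟩)
      rw [Equiv.symm_apply_apply] at this
      exact hM ⟨_, hcon⟩ this
    have := hT k _ hg (fun j => (eT.symm j).1) (fun j => (eT.symm j).2)
    rwa [show x = _ from funext hy2]

/-- `Inv(C*) = ⟨C•⟩∃`; consequently `T` is closed under `C*`
iff `T ∈ ⟨C∘⟩∃`. -/
theorem stmt_3 {A : Type*} [Finite A] (C : OpFamily A) (hC : IsClone C) :
    (∀ (h : ℕ) (ρ : Set (Fin h → A)),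
        MemInv (Centralizer C) ρ ↔ PPDef (GraphRels C) h ρ) ∧
    (∀ (n : ℕ) (T : Set (Fin n → A)),
        ClosedUnder (Centralizer C) T ↔ PPDef (SolRels C) n T) := by
  have hclosed : ∀ (n : ℕ) (T : Set (Fin n → A)), PPDef (SolRels C) n T →
      MemInv (Centralizer C) T := fun n T h m g hg =>
    PPDef.preserved g (preserves_sol C hg) h
  exact ⟨fun h ρ => ⟨pp_of_closed C h ρ,
      fun hp => hclosed h ρ (hp.mono (graph_subset_sol C hC))⟩,
    fun n T => ⟨fun h => (pp_of_closed C n T h).mono (graph_subset_sol C hC), hclosed n T⟩⟩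
end

section
/- Let L = (L, ∧, ∨) be a finite lattice. If the clone C = [∧,∨] has Property SDC, then L is a distributive lattice. -/
/-- Binary lattice terms are one of four functions. -/
lemma binary_term {L : Type*} [Lattice L] {n : ℕ} {f : (Fin n → L) → L}
    (hf : LatticeTerm L n f) (i j : Fin n) (hij : ∀ k, k = i ∨ k = j) :
    (∀ x, f x = x i) ∨ (∀ x, f x = x j) ∨ (∀ x, f x = x i ⊓ x j) ∨
      (∀ x, f x = x i ⊔ x j) := by
  induction hf with
  | proj k => rcases hij k with rfl | rfl <;> simp
  | inf _ _ h1 h2 =>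
    rcases h1 with h1 | h1 | h1 | h1 <;> rcases h2 with h2 | h2 | h2 | h2 <;>
      simp only [h1, h2]
    all_goals first
      | (left; intro x; simp; done)
      | (right; left; intro x; simp; done)
      | (right; right; left; intro x; simp [inf_comm, inf_left_comm]; done)
      | (right; right; left; intro x
         exact inf_eq_left.2 (inf_le_left.trans le_sup_left))
      | (right; right; left; intro x
         exact inf_eq_right.2 (inf_le_left.trans le_sup_left))
      | (right; right; right; intro x; simp; done)
  | sup _ _ h1 h2 =>
    rcases h1 with h1 | h1 | h1 | h1 <;> rcases h2 with h2 | h2 | h2 | h2 <;>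
      simp only [h1, h2]
    all_goals first
      | (left; intro x; simp; done)
      | (right; left; intro x; simp; done)
      | (right; right; right; intro x; simp [sup_comm, sup_left_comm]; done)
      | (right; right; right; intro x
         exact sup_eq_left.2 (inf_le_left.trans le_sup_left))
      | (right; right; right; intro x
         exact sup_eq_right.2 (inf_le_left.trans le_sup_left))
      | (right; right; left; intro x; simp; done)

/-- Uniqueness of relative complements implies distributivity. -/
lemma distrib_of_cancel {L : Type*} [Lattice L]
    (hc : ∀ x y z : L, x ⊓ z = y ⊓ z → x ⊔ z = y ⊔ z → x = y) :
    ∀ x y z : L, x ⊓ (y ⊔ z) = (x ⊓ y) ⊔ (x ⊓ z) := by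
  have md : ∀ a b c : L, a ≤ b → a ⊔ (c ⊓ b) = (a ⊔ c) ⊓ b := by
    intro a b c hab
    have hpq : a ⊔ (c ⊓ b) ≤ (a ⊔ c) ⊓ b :=
      sup_le (le_inf le_sup_left hab) (inf_le_inf_right _ le_sup_right)
    apply hc _ _ c
    · apply le_antisymm (inf_le_inf_right _ hpq)
      refine le_inf ?_ inf_le_right
      exact le_sup_of_le_right (le_inf inf_le_right (inf_le_left.trans inf_le_right))
    · apply le_antisymm (sup_le_sup_right hpq _)
      refine sup_le ?_ le_sup_right
      exact inf_le_left.trans (sup_le_sup_right le_sup_left _)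
  -- the two forms of the elements of the diamond
  have forms : ∀ x y z : L, (y ⊓ z) ⊔ (x ⊓ (y ⊔ z)) = ((y ⊓ z) ⊔ x) ⊓ (y ⊔ z) :=
    fun x y z => md _ _ _ (inf_le_left.trans le_sup_left)
  have meet : ∀ x y z : L, ((y ⊓ z) ⊔ (x ⊓ (y ⊔ z))) ⊓ ((x ⊓ z) ⊔ (y ⊓ (x ⊔ z))) =
      (y ⊓ z) ⊔ ((x ⊓ z) ⊔ (y ⊓ x)) := by
    intro x y z
    have e : (y ⊓ z) ⊔ ((x ⊓ z) ⊔ (y ⊓ x)) = ((y ⊓ z) ⊔ x) ⊓ ((x ⊓ z) ⊔ y) := by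
      rw [← md (y ⊓ z) ((x ⊓ z) ⊔ y) x (le_sup_of_le_right inf_le_left),
        md (x ⊓ z) x y inf_le_left, inf_comm x (x ⊓ z ⊔ y)]
    rw [e, forms, forms]
    apply le_antisymm
    · exact inf_le_inf inf_le_left inf_le_left
    · refine le_inf (le_inf inf_le_left (inf_le_right.trans ?_))
        (le_inf inf_le_right (inf_le_left.trans ?_))
      · exact sup_le (le_sup_of_le_right inf_le_right) le_sup_left
      · exact sup_le (le_sup_of_le_right inf_le_right) le_sup_left
  have join : ∀ x y z : L, ((y ⊓ z) ⊔ (x ⊓ (y ⊔ z))) ⊔ ((x ⊓ z) ⊔ (y ⊓ (x ⊔ z))) =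
      (y ⊔ z) ⊓ ((x ⊔ z) ⊓ (y ⊔ x)) := by
    intro x y z
    have e : (y ⊔ z) ⊓ ((x ⊔ z) ⊓ (y ⊔ x)) = (x ⊓ (y ⊔ z)) ⊔ (y ⊓ (x ⊔ z)) := by
      have h1 := md (y ⊓ (x ⊔ z)) (y ⊔ z) x (inf_le_left.trans le_sup_left)
      have h2 := md x (x ⊔ z) y le_sup_left
      rw [sup_comm (x ⊓ (y ⊔ z)), h1, sup_comm (y ⊓ (x ⊔ z)) x, h2, inf_comm (y ⊔ z), sup_comm y x,
        inf_comm (x ⊔ z) (x ⊔ y)]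
    rw [e]
    apply le_antisymm
    · refine sup_le (sup_le ?_ le_sup_left) (sup_le ?_ le_sup_right)
      · exact le_sup_of_le_right (inf_le_inf_left _ le_sup_right)
      · exact le_sup_of_le_left (inf_le_inf_left _ le_sup_right)
    · exact sup_le_sup le_sup_right le_sup_right
  intro x y z
  have m1 := meet x y z
  have m2 := meet x z y
  have m3 := meet y z x
  have j1 := join x y z
  have j2 := join x z y
  have j3 := join y z x
  have hab : (y ⊓ z) ⊔ (x ⊓ (y ⊔ z)) = (x ⊓ z) ⊔ (y ⊓ (x ⊔ z)) := by
    apply hc _ _ ((x ⊓ y) ⊔ (z ⊓ (x ⊔ y)))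
    · rw [inf_comm z y, sup_comm z y] at m2
      rw [inf_comm z x, sup_comm z x, inf_comm y x, sup_comm y x] at m3
      rw [m2, m3]
      simp only [inf_comm, sup_comm, sup_left_comm, sup_assoc]
    · rw [inf_comm z y, sup_comm z y] at j2
      rw [inf_comm z x, sup_comm z x, inf_comm y x, sup_comm y x] at j3
      rw [j2, j3]
      simp only [inf_comm, sup_comm, inf_left_comm, inf_assoc]
  rw [← hab, inf_idem] at m1
  rw [← hab, sup_idem, m1] at j1
  apply le_antisymm
  · have k1 : x ⊓ (y ⊔ z) ≤ x ⊓ ((y ⊓ z) ⊔ ((x ⊓ z) ⊔ (y ⊓ x))) := by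
      rw [j1]
      exact le_inf inf_le_left (le_inf inf_le_right
        (le_inf (inf_le_left.trans le_sup_left) (inf_le_left.trans le_sup_right)))
    refine k1.trans ?_
    have k2 := md ((x ⊓ z) ⊔ (y ⊓ x)) x (y ⊓ z) (sup_le inf_le_left inf_le_right)
    rw [inf_comm x, sup_comm (y ⊓ z), ← k2]
    refine sup_le (sup_le le_sup_right ?_) ?_
    · rw [inf_comm]; exact le_sup_left
    · exact le_sup_of_le_left (le_inf inf_le_right (inf_le_left.trans inf_le_left))
  · exact sup_le (inf_le_inf_left _ le_sup_left) (inf_le_inf_left _ le_sup_right)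

theorem stmt_6 {L : Type*} [Lattice L] [Fintype L]
    (h : HasSDC (LatticeClone L)) :
    ∀ x y z : L, x ⊓ (y ⊔ z) = (x ⊓ y) ⊔ (x ⊓ z) := by
  apply distrib_of_cancel
  by_contra hcon
  push Not at hcon
  obtain ⟨x, y, z, h1, h2, hne⟩ := hcon
  let T : Set (Fin 2 → L) := {a | ∃ z, a 0 ⊓ z = a 1 ⊓ z ∧ a 0 ⊔ z = a 1 ⊔ z}
  have hT : ClosedUnder (Centralizer (LatticeClone L)) T := by
    intro m g hg t ht
    choose w hw1 hw2 using ht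
    have hinf : ∀ u v : Fin m → L, g u ⊓ g v = g (fun j => u j ⊓ v j) := by
      intro u v
      have := hg 2 (fun x => x 0 ⊓ x 1) (.inf (.proj 0) (.proj 1)) ![u, v]
      simpa using this
    have hsup : ∀ u v : Fin m → L, g u ⊔ g v = g (fun j => u j ⊔ v j) := by
      intro u v
      have := hg 2 (fun x => x 0 ⊔ x 1) (.sup (.proj 0) (.proj 1)) ![u, v]
      simpa using this
    refine ⟨g w, ?_, ?_⟩
    · simp only [hinf, hw1]
    · simp only [hsup, hw2]
  obtain ⟨t, f, g, hf, hg, hTe⟩ := (h 2 T).2 hT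
  have hxy : ![x, y] ∈ T := ⟨z, by simpa using h1, by simpa using h2⟩
  have hyx : ![y, x] ∈ T := ⟨z, by simpa using h1.symm, by simpa using h2.symm⟩
  haveI : Nonempty L := ⟨x⟩
  letI : BoundedOrder L := Fintype.toBoundedOrder L
  have hbt : ![(⊥ : L), ⊤] ∈ T := by
    rw [hTe] at hxy hyx ⊢
    intro i
    have e1 := hxy i
    have e2 := hyx i
    have h01 : ∀ k : Fin 2, k = 0 ∨ k = 1 := by decide
    rcases binary_term (hf i) 0 1 h01 with hf | hf | hf | hf <;>
    rcases binary_term (hg i) 0 1 h01 with hg | hg | hg | hg <;>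
    simp only [hf, hg, Matrix.cons_val_zero, Matrix.cons_val_one] at e1 e2 ⊢ <;>
    exfalso <;> apply hne <;> first
      | exact e1
      | exact e1.symm
      | (simp at e1 e2; exact le_antisymm e1 e2)
      | (simp at e1 e2; exact le_antisymm e2 e1)
      | (simp at e1 e2; exact e1)
      | (simp at e1 e2; exact e1.symm)
      | (exact inf_eq_sup.1 e1)
      | (exact inf_eq_sup.1 e1.symm)
  obtain ⟨w, hw1, hw2⟩ := hbt
  simp at hw1 hw2
  have hb : (⊥ : L) = ⊤ := hw1.symm ▸ hw2 ▸ rfl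
  exact hne (le_antisymm (le_top.trans (hb ▸ bot_le)) (le_top.trans (hb ▸ bot_le)))
end

section
/- Let L = (L, ∧, ∨) be a finite distributive lattice. If the clone C = [∧,∨] has Property SDC, then L is a Boolean lattice, i.e., every element of L has a complement. -/
lemma latticeTerm_triple {L : Type*} [Lattice L] [BoundedOrder L] (x : L) {n : ℕ}
    {f : (Fin n → L) → L} (hf : LatticeTerm L n f) (u v w : Fin n → L)
    (H : ∀ i, (u i = ⊥ ∧ v i = ⊥ ∧ w i = ⊥) ∨ (u i = ⊥ ∧ v i = x ∧ w i = ⊤) ∨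
      (u i = ⊤ ∧ v i = ⊤ ∧ w i = ⊤)) :
    (f u = ⊥ ∧ f v = ⊥ ∧ f w = ⊥) ∨ (f u = ⊥ ∧ f v = x ∧ f w = ⊤) ∨
      (f u = ⊤ ∧ f v = ⊤ ∧ f w = ⊤) := by
  induction hf with
  | proj i => exact H i
  | inf _ _ ih1 ih2 =>
    rcases ih1 with ⟨a, b, c⟩ | ⟨a, b, c⟩ | ⟨a, b, c⟩ <;>
    rcases ih2 with ⟨a', b', c'⟩ | ⟨a', b', c'⟩ | ⟨a', b', c'⟩ <;>
    simp [a, b, c, a', b', c']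
  | sup _ _ ih1 ih2 =>
    rcases ih1 with ⟨a, b, c⟩ | ⟨a, b, c⟩ | ⟨a, b, c⟩ <;>
    rcases ih2 with ⟨a', b', c'⟩ | ⟨a', b', c'⟩ | ⟨a', b', c'⟩ <;>
    simp [a, b, c, a', b', c']

/-- if the clone `[∧,∨]` of a finite distributive lattice has
Property SDC, then every element has a complement (i.e. the lattice is Boolean). -/
theorem stmt_7 {L : Type*} [DistribLattice L] [Fintype L] [Nonempty L]
    (h : HasSDC (LatticeClone L)) :
    ∀ x : L, ∃ y : L, (∀ z : L, x ⊓ y ≤ z) ∧ (∀ z : L, z ≤ x ⊔ y) := by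
  intro x
  letI : BoundedOrder L := Fintype.toBoundedOrder L
  have hs := (h 3 {a | ∃ y, a 1 ⊓ y = a 0 ∧ a 1 ⊔ y = a 2}).2 (by
    intro m g hg t ht
    choose y hy using ht
    refine ⟨g y, ?_, ?_⟩
    · have := hg 2 _ (LatticeTerm.inf (LatticeTerm.proj 0) (LatticeTerm.proj 1))
        ![fun j => t j 1, y]
      simpa [hy] using this
    · have := hg 2 _ (LatticeTerm.sup (LatticeTerm.proj 0) (LatticeTerm.proj 1))
        ![fun j => t j 1, y]
      simpa [hy] using this)
  obtain ⟨k, f, g, hf, hg, hT⟩ := hs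
  have h1 : (![⊥, ⊥, ⊤] : Fin 3 → L) ∈ {a : Fin 3 → L | ∃ y, a 1 ⊓ y = a 0 ∧ a 1 ⊔ y = a 2} :=
    ⟨⊤, by simp⟩
  have h2 : (![⊥, ⊤, ⊤] : Fin 3 → L) ∈ {a : Fin 3 → L | ∃ y, a 1 ⊓ y = a 0 ∧ a 1 ⊔ y = a 2} :=
    ⟨⊥, by simp⟩
  have h3 : (![⊥, x, ⊤] : Fin 3 → L) ∈ {a : Fin 3 → L | ∃ y, a 1 ⊓ y = a 0 ∧ a 1 ⊔ y = a 2} := by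
    rw [hT] at h1 h2 ⊢
    intro i
    have e1 := h1 i
    have e2 := h2 i
    have H : ∀ i : Fin 3, ((![⊥, ⊥, ⊤] : Fin 3 → L) i = ⊥ ∧ (![⊥, x, ⊤] : Fin 3 → L) i = ⊥ ∧
        (![⊥, ⊤, ⊤] : Fin 3 → L) i = ⊥) ∨ ((![⊥, ⊥, ⊤] : Fin 3 → L) i = ⊥ ∧
        (![⊥, x, ⊤] : Fin 3 → L) i = x ∧ (![⊥, ⊤, ⊤] : Fin 3 → L) i = ⊤) ∨
        ((![⊥, ⊥, ⊤] : Fin 3 → L) i = ⊤ ∧ (![⊥, x, ⊤] : Fin 3 → L) i = ⊤ ∧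
        (![⊥, ⊤, ⊤] : Fin 3 → L) i = ⊤) := by
      intro i
      fin_cases i <;> simp
    have tr : (⊥ : L) = ⊤ → ∀ a b : L, a = b := fun e a b =>
      (le_top.trans (e ▸ bot_le)).antisymm (le_top.trans (e ▸ bot_le))
    rcases latticeTerm_triple x (hf i) _ _ _ H with ⟨a, b, c⟩ | ⟨a, b, c⟩ | ⟨a, b, c⟩ <;>
    rcases latticeTerm_triple x (hg i) _ _ _ H with ⟨a', b', c'⟩ | ⟨a', b', c'⟩ | ⟨a', b', c'⟩ <;>
    first
    | exact b.trans b'.symm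
    | (rw [a, a'] at e1; exact tr e1 _ _)
    | (rw [a, a'] at e1; exact tr e1.symm _ _)
    | (rw [c, c'] at e2; exact tr e2 _ _)
    | (rw [c, c'] at e2; exact tr e2.symm _ _)
  obtain ⟨y, hy1, hy2⟩ := h3
  simp at hy1 hy2
  exact ⟨y, fun z => by simp [hy1], fun z => by simp [hy2]⟩
end

section
/- Let L be a distributive lattice and for x, y, z, u ∈ L set p(x,y,z,u) = (x∧y) ∨ (x∧z) ∨ (y∧z) ∨ (u∧x) ∨ (u∧y) ∨ (u∧z). Then for all x, y, z, u ∈ L: p(x,y,z,u) = x ∨ y ∨ z ∨ u if and only if m(x,y,z) ∨ u = x ∨ y ∨ z. -/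
/-- in a distributive lattice, `p(x,y,z,u) = x ∨ y ∨ z ∨ u`
iff `m(x,y,z) ∨ u = x ∨ y ∨ z`. -/
theorem stmt_8 {L : Type*} [DistribLattice L] :
    ∀ x y z u : L,
      ((x ⊓ y) ⊔ (x ⊓ z) ⊔ (y ⊓ z) ⊔ (u ⊓ x) ⊔ (u ⊓ y) ⊔ (u ⊓ z)
          = x ⊔ y ⊔ z ⊔ u)
        ↔ ((x ⊓ y) ⊔ (x ⊓ z) ⊔ (y ⊓ z)) ⊔ u = x ⊔ y ⊔ z := by
  intro x y z u
  have hp : (x ⊓ y) ⊔ (x ⊓ z) ⊔ (y ⊓ z) ⊔ (u ⊓ x) ⊔ (u ⊓ y) ⊔ (u ⊓ z)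
      = ((x ⊓ y) ⊔ (x ⊓ z) ⊔ (y ⊓ z)) ⊔ (u ⊓ (x ⊔ y ⊔ z)) := by
    simp only [inf_sup_left, sup_assoc]
  have hm : (x ⊓ y) ⊔ (x ⊓ z) ⊔ (y ⊓ z) ≤ x ⊔ y ⊔ z :=
    sup_le (sup_le (inf_le_left.trans (le_sup_left.trans le_sup_left))
      (inf_le_right.trans le_sup_right)) (inf_le_right.trans le_sup_right)
  rw [hp]
  generalize (x ⊓ y) ⊔ (x ⊓ z) ⊔ (y ⊓ z) = m at *
  generalize x ⊔ y ⊔ z = s at *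
  constructor
  · intro h
    have hu : u ≤ s := le_sup_right.trans (h.ge.trans (sup_le hm inf_le_right))
    rwa [inf_eq_left.2 hu, sup_eq_left.2 hu] at h
  · intro h
    have hu : u ≤ s := le_sup_right.trans h.le
    rwa [inf_eq_left.2 hu, sup_eq_left.2 hu]
end

section
/- If L = (L, ∧, ∨) is a finite Boolean lattice (a complemented distributive lattice), then the clone C = [∧,∨] has Property SDC. -/
theorem aux_supPrime {L : Type*} [DistribLattice L] [BoundedOrder L] {p : L} (hp : IsAtom p) :
    SupPrime p := by
  refine ⟨fun h => hp.1 h.eq_bot, ?_⟩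
  intro x y hxy
  by_contra! hcon
  obtain ⟨h1, h2⟩ := hcon
  have h1' : p ⊓ x = ⊥ := (hp.not_le_iff_disjoint.1 h1).eq_bot
  have h2' : p ⊓ y = ⊥ := (hp.not_le_iff_disjoint.1 h2).eq_bot
  apply hp.1
  calc p = p ⊓ (x ⊔ y) := (inf_eq_left.2 hxy).symm
    _ = ⊥ := by rw [inf_sup_left, h1', h2', sup_bot_eq]

theorem aux_atom {L : Type*} [DistribLattice L] [BoundedOrder L] [Fintype L]
    (hcompl : ∀ x : L, ∃ y : L, x ⊓ y = ⊥ ∧ x ⊔ y = ⊤) {x y : L} (h : ¬ x ≤ y) :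
    ∃ q, IsAtom q ∧ q ≤ x ∧ ¬ q ≤ y := by
  obtain ⟨z, hz1, hz2⟩ := hcompl y
  rcases IsAtomic.eq_bot_or_exists_atom_le (x ⊓ z) with h0 | ⟨q, hq, hle⟩
  · exfalso
    apply h
    calc x = x ⊓ (y ⊔ z) := by rw [hz2, inf_top_eq]
      _ = x ⊓ y := by rw [inf_sup_left, h0, sup_bot_eq]
      _ ≤ y := inf_le_right
  · refine ⟨q, hq, hle.trans inf_le_left, fun hy => hq.1 ?_⟩
    have : q ≤ y ⊓ z := le_inf hy (hle.trans inf_le_right)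
    rw [hz1] at this
    exact le_bot_iff.1 this

theorem aux_ext {L : Type*} [DistribLattice L] [BoundedOrder L] [Fintype L]
    (hcompl : ∀ x : L, ∃ y : L, x ⊓ y = ⊥ ∧ x ⊔ y = ⊤) {x y : L}
    (h : ∀ q, IsAtom q → (q ≤ x ↔ q ≤ y)) : x = y := by
  apply le_antisymm
  · by_contra hc
    obtain ⟨q, hq, h1, h2⟩ := aux_atom hcompl hc
    exact h2 ((h q hq).1 h1)
  · by_contra hc
    obtain ⟨q, hq, h1, h2⟩ := aux_atom hcompl hc
    exact h2 ((h q hq).2 h1)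

theorem aux_inf {L : Type*} [DistribLattice L] [BoundedOrder L] {n : ℕ} (s : Finset (Fin n))
    (hs : s.Nonempty) : LatticeTerm L n (fun x => s.inf x) := by
  induction hs using Finset.Nonempty.cons_induction with
  | singleton a => simpa using LatticeTerm.proj a
  | cons a s ha hs ih => simpa using LatticeTerm.inf (LatticeTerm.proj a) ih

theorem aux_sup {L : Type*} [DistribLattice L] [BoundedOrder L] {n : ℕ} (s : Finset (Fin n))
    (hs : s.Nonempty) : LatticeTerm L n (fun x => s.sup x) := by
  induction hs using Finset.Nonempty.cons_induction with
  | singleton a => simpa using LatticeTerm.proj a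
  | cons a s ha hs ih => simpa using LatticeTerm.sup (LatticeTerm.proj a) ih

theorem aux_comm {L : Type*} [Lattice L] {m : ℕ} (h : (Fin m → L) → L)
    (hinf : ∀ x y, h (x ⊓ y) = h x ⊓ h y) (hsup : ∀ x y, h (x ⊔ y) = h x ⊔ h y) :
    h ∈ Centralizer (LatticeClone L) m := by
  intro n f hf M
  have hf' : LatticeTerm L n f := hf
  induction hf' with
  | proj i => rfl
  | inf h1 h2 ih1 ih2 =>
    beta_reduce; rw [ih1 h1, ih2 h2, ← hinf]; rfl
  | sup h1 h2 ih1 ih2 =>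
    beta_reduce; rw [ih1 h1, ih2 h2, ← hsup]; rfl

theorem aux_const {L : Type*} [Lattice L] {n : ℕ} {T : Set (Fin n → L)}
    (hT : ClosedUnder (Centralizer (LatticeClone L)) T) (c : L) : (fun _ => c) ∈ T :=
  hT 0 (fun _ => c) (aux_comm _ (fun _ _ => by simp) (fun _ _ => by simp)) (fun j => j.elim0)
    (fun j => j.elim0)

theorem aux_key {L : Type*} [DistribLattice L] [BoundedOrder L] [Fintype L]
    (hcompl : ∀ x : L, ∃ y : L, x ⊓ y = ⊥ ∧ x ⊔ y = ⊤) {n : ℕ} {T : Set (Fin n → L)}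
    (hT : ClosedUnder (Centralizer (LatticeClone L)) T) (a : Fin n → L)
    (ha : ∀ f g, LatticeTerm L n f → LatticeTerm L n g → (∀ t ∈ T, f t = g t) → f a = g a)
    (p : L) (hp : IsAtom p) :
    ∃ t ∈ T, ∃ q, IsAtom q ∧ ∀ i, p ≤ a i ↔ q ≤ t i := by
  classical
  by_cases hF : ∀ i, ¬ p ≤ a i
  · refine ⟨_, aux_const hT ⊥, p, hp, fun i => ?_⟩
    simp [hF i, hp.1]
  by_cases hI : ∀ i, p ≤ a i
  · exact ⟨_, aux_const hT ⊤, p, hp, fun i => by simp [hI i]⟩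
  push Not at hF hI
  obtain ⟨i0, hi0⟩ := hF
  obtain ⟨i1, hi1⟩ := hI
  set F : Finset (Fin n) := Finset.univ.filter (fun i => p ≤ a i) with hFdef
  set I : Finset (Fin n) := Finset.univ.filter (fun i => ¬ p ≤ a i) with hIdef
  have hF := aux_inf (L := L) F ⟨i0, by simp [hFdef, hi0]⟩
  have hI := aux_sup (L := L) I ⟨i1, by simp [hIdef, hi1]⟩
  have hne : ¬ ∀ t ∈ T, F.inf t = F.inf t ⊓ I.sup t := by
    intro hcon
    have h1 := ha _ _ hF (LatticeTerm.inf hF hI) hcon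
    have h2 : p ≤ F.inf a := Finset.le_inf (fun i hi => by simpa [hFdef] using hi)
    have h1' : F.inf a = F.inf a ⊓ I.sup a := h1
    rw [h1'] at h2
    obtain ⟨i, hi, hle⟩ := ((aux_supPrime hp).le_finset_sup).1 (h2.trans inf_le_right)
    simp [hIdef] at hi
    exact hi hle
  push Not at hne
  obtain ⟨t, htT, ht⟩ := hne
  have hnle : ¬ F.inf t ≤ I.sup t := fun h => ht (inf_eq_left.2 h).symm
  obtain ⟨q, hq, h1, h2⟩ := aux_atom hcompl hnle
  refine ⟨t, htT, q, hq, fun i => ⟨fun hi => ?_, fun hi => ?_⟩⟩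
  · exact h1.trans (Finset.inf_le (by simp [hFdef, hi]))
  · by_contra hc
    exact h2 (hi.trans (Finset.le_sup (f := t) (by simp [hIdef, hc])))

theorem aux_mem {L : Type*} [DistribLattice L] [BoundedOrder L] [Fintype L]
    (hcompl : ∀ x : L, ∃ y : L, x ⊓ y = ⊥ ∧ x ⊔ y = ⊤) {n : ℕ} {T : Set (Fin n → L)}
    (hT : ClosedUnder (Centralizer (LatticeClone L)) T) (a : Fin n → L)
    (ha : ∀ f g, LatticeTerm L n f → LatticeTerm L n g → (∀ t ∈ T, f t = g t) → f a = g a) :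
    a ∈ T := by
  classical
  have key : ∀ p : {p : L // IsAtom p}, ∃ t ∈ T, ∃ q, IsAtom q ∧ ∀ i, p.1 ≤ a i ↔ q ≤ t i :=
    fun p => aux_key hcompl hT a ha p.1 p.2
  choose t htT q hq hpq using key
  let e := Finite.equivFin {p : L // IsAtom p}
  let h : (Fin (Nat.card {p : L // IsAtom p}) → L) → L := fun x =>
    (Finset.univ.filter (fun p : {p : L // IsAtom p} => q p ≤ x (e p))).sup (fun p => p.1)
  have hh : ∀ (x) (p : {p : L // IsAtom p}), p.1 ≤ h x ↔ q p ≤ x (e p) := by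
    intro x p
    constructor
    · intro hle
      obtain ⟨p', hp', hle'⟩ := ((aux_supPrime p.2).le_finset_sup).1 hle
      have : p = p' := by
        apply Subtype.ext
        exact (p'.2.le_iff.1 hle').resolve_left p.2.1
      subst this
      simpa using hp'
    · intro hle
      exact Finset.le_sup (f := fun p : {p : L // IsAtom p} => p.1) (by simp [hle])
  have hc : h ∈ Centralizer (LatticeClone L) _ := by
    apply aux_comm
    · intro x y
      apply aux_ext hcompl
      intro p hp
      have h1 := fun z => hh z ⟨p, hp⟩
      simp only [] at h1
      rw [le_inf_iff, h1, h1, h1, Pi.inf_apply, le_inf_iff]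
    · intro x y
      apply aux_ext hcompl
      intro p hp
      have h1 := fun z => hh z ⟨p, hp⟩
      simp only [] at h1
      rw [(aux_supPrime hp).le_sup, h1, h1, h1, Pi.sup_apply, (aux_supPrime (hq _)).le_sup]
  have hm := hT _ h hc (fun j => t (e.symm j)) (fun j => htT _)
  convert hm using 1
  funext i
  apply aux_ext hcompl
  intro p hp
  have h1 := hh (fun j => t (e.symm j) i) ⟨p, hp⟩
  simp only [Equiv.symm_apply_apply] at h1
  rw [h1]
  exact hpq ⟨p, hp⟩ i

/-- the clone `[∧,∨]` of a finite Boolean lattice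
(complemented distributive lattice) has Property SDC. -/
theorem stmt_12 {L : Type*} [DistribLattice L] [BoundedOrder L] [Fintype L]
    (hcompl : ∀ x : L, ∃ y : L, x ⊓ y = ⊥ ∧ x ⊔ y = ⊤) :
    HasSDC (LatticeClone L) := by
  classical
  intro n T
  constructor
  · rintro ⟨k, f, g, hf, hg, rfl⟩ m h hh t ht i
    have h1 := hh n (f i) (hf i) (fun i j => t j i)
    have h2 := hh n (g i) (hg i) (fun i j => t j i)
    rw [h1, h2]
    congr 1
    funext j
    exact ht j i
  · intro hT
    let P := {fg : ((Fin n → L) → L) × ((Fin n → L) → L) //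
      LatticeTerm L n fg.1 ∧ LatticeTerm L n fg.2 ∧ ∀ t ∈ T, fg.1 t = fg.2 t}
    let e := Finite.equivFin P
    refine ⟨Nat.card P, fun i => (e.symm i).1.1, fun i => (e.symm i).1.2,
      fun i => (e.symm i).2.1, fun i => (e.symm i).2.2.1, ?_⟩
    ext a
    constructor
    · intro ha i
      exact (e.symm i).2.2.2 a ha
    · intro ha
      apply aux_mem hcompl hT a
      intro f g hf hg hfg
      have := ha (e ⟨(f, g), hf, hg, hfg⟩)
      simpa using this
end

section
/- A finite lattice L = (L, ∧, ∨) has Property SDC for the clone [∧,∨] if and only if L is a Boolean lattice, i.e., L is distributive and every element of L has a complement. -/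
section Helpers

/-- On monotone tuples every lattice term is a projection. -/
theorem term_chain {L : Type*} [Lattice L] {n : ℕ} {f : (Fin n → L) → L}
    (hf : LatticeTerm L n f) : ∃ i, ∀ x : Fin n → L, Monotone x → f x = x i := by
  induction hf with
  | proj i => exact ⟨i, fun _ _ => rfl⟩
  | inf _ _ ih1 ih2 =>
    obtain ⟨i, hi⟩ := ih1
    obtain ⟨j, hj⟩ := ih2
    refine ⟨min i j, fun x hx => ?_⟩
    simp only [hi x hx, hj x hx]
    rcases le_total i j with h | h
    · rw [min_eq_left h, inf_eq_left.2 (hx h)]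
    · rw [min_eq_right h, inf_eq_right.2 (hx h)]
  | sup _ _ ih1 ih2 =>
    obtain ⟨i, hi⟩ := ih1
    obtain ⟨j, hj⟩ := ih2
    refine ⟨max i j, fun x hx => ?_⟩
    simp only [hi x hx, hj x hx]
    rcases le_total i j with h | h
    · rw [max_eq_right h, sup_eq_right.2 (hx h)]
    · rw [max_eq_left h, sup_eq_left.2 (hx h)]

/-- If a solution set separates coordinates by monotone tuples,
it contains all monotone tuples. -/
theorem chain_mem {L : Type*} [Lattice L] {n : ℕ} {T : Set (Fin n → L)}
    (hT : IsSolutionSet (LatticeClone L) n T)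
    (hsep : ∀ i j : Fin n, i < j → ∃ x ∈ T, Monotone x ∧ x i ≠ x j)
    (a : Fin n → L) (ha : Monotone a) : a ∈ T := by
  obtain ⟨t, f, g, hf, hg, rfl⟩ := hT
  intro k
  obtain ⟨i, hi⟩ := term_chain (hf k)
  obtain ⟨j, hj⟩ := term_chain (hg k)
  rw [hi a ha, hj a ha]
  rcases lt_trichotomy i j with h | h | h
  · obtain ⟨x, hx, hm, hne⟩ := hsep i j h
    have := hx k
    rw [hi x hm, hj x hm] at this
    exact absurd this hne
  · rw [h]
  · obtain ⟨x, hx, hm, hne⟩ := hsep j i h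
    have := hx k
    rw [hi x hm, hj x hm] at this
    exact absurd this.symm hne

theorem cent_inf {L : Type*} [Lattice L] {m : ℕ} {h : (Fin m → L) → L}
    (hh : h ∈ Centralizer (LatticeClone L) m) (x y : Fin m → L) :
    h (fun j => x j ⊓ y j) = h x ⊓ h y := by
  have := hh 2 (fun x => x 0 ⊓ x 1) (.inf (.proj 0) (.proj 1)) ![x, y]
  simpa using this.symm

theorem cent_sup {L : Type*} [Lattice L] {m : ℕ} {h : (Fin m → L) → L}
    (hh : h ∈ Centralizer (LatticeClone L) m) (x y : Fin m → L) :
    h (fun j => x j ⊔ y j) = h x ⊔ h y := by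
  have := hh 2 (fun x => x 0 ⊔ x 1) (.sup (.proj 0) (.proj 1)) ![x, y]
  simpa using this.symm

theorem mem_cent {L : Type*} [Lattice L] {m : ℕ} {h : (Fin m → L) → L}
    (hi : ∀ x y : Fin m → L, h (fun j => x j ⊓ y j) = h x ⊓ h y)
    (hs : ∀ x y : Fin m → L, h (fun j => x j ⊔ y j) = h x ⊔ h y) :
    h ∈ Centralizer (LatticeClone L) m := by
  intro n f hf M
  induction (show LatticeTerm L n f from hf) with
  | proj i => rfl
  | inf h1 h2 ih1 ih2 =>
    rw [hi, ← ih1 h1, ← ih2 h2]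
  | sup h1 h2 ih1 ih2 =>
    rw [hs, ← ih1 h1, ← ih2 h2]

theorem sol_closed {A : Type*} (C : OpFamily A) (n : ℕ) (T : Set (Fin n → A))
    (hT : IsSolutionSet C n T) : ClosedUnder (Centralizer C) T := by
  obtain ⟨t, f, g, hf, hg, rfl⟩ := hT
  intro m h hh x hx k
  have h1 := hh n (f k) (hf k) (fun i j => x j i)
  have h2 := hh n (g k) (hg k) (fun i j => x j i)
  rw [h1, h2]
  congr 1
  funext j
  exact hx j k

theorem sdc_distrib {L : Type*} [Lattice L] [BoundedOrder L]
    (H : HasSDC (LatticeClone L)) (x y z : L) : x ⊓ (y ⊔ z) = (x ⊓ y) ⊔ (x ⊓ z) := by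
  let T : Set (Fin 2 → L) :=
    {a | ∃ u v w : L, a 0 = (u ⊓ v) ⊔ (u ⊓ w) ∧ a 1 = u ⊓ (v ⊔ w)}
  have hT : IsSolutionSet (LatticeClone L) 2 T := by
    rw [H]
    intro m h hh t ht
    choose u v w h0 h1 using ht
    refine ⟨h u, h v, h w, ?_, ?_⟩
    · simp only [h0, cent_inf hh, cent_sup hh]
    · simp only [h1, cent_inf hh, cent_sup hh]
  by_contra hne
  have hmem : (![⊥, ⊤] : Fin 2 → L) ∈ T := by
    refine chain_mem hT ?_ _ ?_
    · intro i j hij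
      refine ⟨![(x ⊓ y) ⊔ (x ⊓ z), x ⊓ (y ⊔ z)], ⟨x, y, z, rfl, rfl⟩, ?_, ?_⟩
      · rw [Fin.monotone_iff_le_succ]
        intro i
        fin_cases i
        exact le_inf_sup
      · fin_cases i <;> fin_cases j <;> simp at hij ⊢
        exact fun h => hne h.symm
    · rw [Fin.monotone_iff_le_succ]
      intro i
      fin_cases i
      exact bot_le
  obtain ⟨u, v, w, h0, h1⟩ := hmem
  simp only [Matrix.cons_val_zero, Matrix.cons_val_one] at h0 h1
  have hu : u = ⊤ := top_le_iff.1 (h1 ▸ inf_le_left)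
  subst hu
  simp only [top_inf_eq] at h0 h1
  have hbt : (⊥ : L) = ⊤ := h0.trans h1.symm
  exact hne ((eq_bot_of_bot_eq_top hbt _).trans (eq_bot_of_bot_eq_top hbt _).symm)

theorem sdc_compl {L : Type*} [Lattice L] [BoundedOrder L]
    (H : HasSDC (LatticeClone L)) (x : L) : ∃ y : L, x ⊓ y = ⊥ ∧ x ⊔ y = ⊤ := by
  let T : Set (Fin 3 → L) := {a | ∃ w : L, a 1 ⊓ w = a 0 ∧ a 1 ⊔ w = a 2}
  have hT : IsSolutionSet (LatticeClone L) 3 T := by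
    rw [H]
    intro m h hh t ht
    choose w h0 h1 using ht
    refine ⟨h w, ?_, ?_⟩
    · simp only [← h0, cent_inf hh]
    · simp only [← h1, cent_sup hh]
  by_cases hbt : (⊥ : L) = ⊤
  · exact ⟨⊥, eq_bot_of_bot_eq_top hbt _, (eq_bot_of_bot_eq_top hbt _).trans hbt⟩
  have hmono : ∀ b : L, Monotone (![⊥, b, ⊤] : Fin 3 → L) := by
    intro b
    rw [Fin.monotone_iff_le_succ]
    intro i
    fin_cases i
    · exact bot_le
    · exact le_top
  have hmem : (![⊥, x, ⊤] : Fin 3 → L) ∈ T := by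
    refine chain_mem hT ?_ _ (hmono x)
    intro i j hij
    by_cases hi : i = 0
    · refine ⟨![⊥, ⊤, ⊤], ⟨⊥, by simp, by simp⟩, hmono _, ?_⟩
      subst hi
      fin_cases j <;> simp at hij ⊢ <;> exact hbt
    · refine ⟨![⊥, ⊥, ⊤], ⟨⊤, by simp, by simp⟩, hmono _, ?_⟩
      fin_cases i <;> fin_cases j <;> simp at hij hi ⊢ <;> exact hbt
  obtain ⟨w, h0, h1⟩ := hmem
  exact ⟨w, h0, h1⟩

theorem term_inf' {L : Type*} [Lattice L] {n : ℕ} (F : Finset (Fin n)) (hF : F.Nonempty) :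
    LatticeTerm L n (fun x => F.inf' hF x) := by
  induction hF using Finset.Nonempty.cons_induction with
  | singleton a => simpa using LatticeTerm.proj a
  | cons a s h hs ih =>
    simp only [Finset.inf'_cons hs]
    exact .inf (.proj a) ih

theorem term_sup' {L : Type*} [Lattice L] {n : ℕ} (F : Finset (Fin n)) (hF : F.Nonempty) :
    LatticeTerm L n (fun x => F.sup' hF x) := by
  induction hF using Finset.Nonempty.cons_induction with
  | singleton a => simpa using LatticeTerm.proj a
  | cons a s h hs ih =>
    simp only [Finset.sup'_cons hs]
    exact .sup (.proj a) ih

theorem atom_supPrime {L : Type*} [BooleanAlgebra L] {p : L} (hp : IsAtom p) : SupPrime p := by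
  refine ⟨fun h => hp.1 (isMin_iff_eq_bot.1 h), ?_⟩
  intro x y h
  by_cases hx : p ≤ x
  · exact Or.inl hx
  · exact Or.inr (Disjoint.left_le_of_le_sup_left h (hp.not_le_iff_disjoint.1 hx))

theorem exists_atom_sep {L : Type*} [BooleanAlgebra L] [Finite L] {x y : L} (h : ¬ x ≤ y) :
    ∃ p, IsAtom p ∧ p ≤ x ∧ ¬ p ≤ y := by
  have hne : x ⊓ yᶜ ≠ ⊥ := by
    intro h0
    exact h (disjoint_compl_right_iff.1 (disjoint_iff.2 h0))
  obtain ⟨p, hp, hle⟩ := (eq_bot_or_exists_atom_le (x ⊓ yᶜ)).resolve_left hne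
  refine ⟨p, hp, hle.trans inf_le_left, fun hy => hp.1 ?_⟩
  have : p ≤ y ⊓ yᶜ := le_inf hy (hle.trans inf_le_right)
  simpa using this

theorem eq_of_atoms {L : Type*} [BooleanAlgebra L] [Finite L] {x y : L}
    (h : ∀ p, IsAtom p → (p ≤ x ↔ p ≤ y)) : x = y := by
  apply le_antisymm
  · by_contra hn
    obtain ⟨p, hp, h1, h2⟩ := exists_atom_sep hn
    exact h2 ((h p hp).1 h1)
  · by_contra hn
    obtain ⟨p, hp, h1, h2⟩ := exists_atom_sep hn
    exact h2 ((h p hp).2 h1)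

theorem bool_sdc {L : Type*} [BooleanAlgebra L] [Finite L] : HasSDC (LatticeClone L) := by
  classical
  intro n T
  refine ⟨sol_closed _ n T, fun hT => ?_⟩
  haveI : Fintype L := Fintype.ofFinite L
  let ι := {P : Finset (Fin n) × Finset (Fin n) //
    ∃ (hF : P.1.Nonempty) (hG : P.2.Nonempty), ∀ t ∈ T, P.1.inf' hF t ≤ P.2.sup' hG t}
  let e : ι ≃ Fin (Fintype.card ι) := Fintype.equivFin ι
  refine ⟨Fintype.card ι,
    fun k x => (e.symm k).1.1.inf' (e.symm k).2.choose x ⊓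
      (e.symm k).1.2.sup' (e.symm k).2.choose_spec.choose x,
    fun k x => (e.symm k).1.1.inf' (e.symm k).2.choose x,
    fun k => .inf (term_inf' _ _) (term_sup' _ _), fun k => term_inf' _ _, ?_⟩
  ext a
  constructor
  · intro ha k
    exact inf_eq_left.2 ((e.symm k).2.choose_spec.choose_spec a ha)
  intro ha
  have key : ∀ (F G : Finset (Fin n)) (hF : F.Nonempty) (hG : G.Nonempty),
      (∀ t ∈ T, F.inf' hF t ≤ G.sup' hG t) → F.inf' hF a ≤ G.sup' hG a := by
    intro F G hF hG h
    have := ha (e ⟨(F, G), hF, hG, h⟩)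
    simp only [Equiv.symm_apply_apply] at this
    exact inf_eq_left.1 this
  clear ha
  let eT : T ≃ Fin (Fintype.card T) := Fintype.equivFin T
  let t : Fin (Fintype.card T) → Fin n → L := fun j => (eT.symm j).1
  have htT : ∀ j, t j ∈ T := fun j => (eT.symm j).2
  have hD : ∀ p : L, ∃ D : (Fin (Fintype.card T) → L) → Prop, IsAtom p →
      (∀ x y, D (fun j => x j ⊓ y j) ↔ D x ∧ D y) ∧
      (∀ x y, D (fun j => x j ⊔ y j) ↔ D x ∨ D y) ∧
      ∀ i, D (fun j => t j i) ↔ p ≤ a i := by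
    intro p
    by_cases hp : IsAtom p
    swap
    · exact ⟨fun _ => True, fun h => absurd h hp⟩
    by_cases hF : (Finset.univ.filter (fun i => p ≤ a i)).Nonempty
    swap
    · refine ⟨fun _ => False, fun _ => ⟨by simp, by simp, fun i => ?_⟩⟩
      simp only [false_iff]
      exact fun hi => hF ⟨i, by simpa using hi⟩
    by_cases hG : (Finset.univ.filter (fun i => ¬ p ≤ a i)).Nonempty
    swap
    · refine ⟨fun _ => True, fun _ => ⟨by simp, by simp, fun i => ?_⟩⟩
      simp only [true_iff]
      by_contra hi
      exact hG ⟨i, by simpa using hi⟩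
    have hex : ∃ s ∈ T, ¬ (Finset.univ.filter (fun i => p ≤ a i)).inf' hF s ≤
        (Finset.univ.filter (fun i => ¬ p ≤ a i)).sup' hG s := by
      by_contra hcon
      push Not at hcon
      have h1 := key _ _ hF hG hcon
      have h2 : p ≤ (Finset.univ.filter (fun i => p ≤ a i)).inf' hF a :=
        Finset.le_inf' _ _ (fun i hi => (Finset.mem_filter.1 hi).2)
      have h3 := h2.trans h1
      rw [Finset.sup'_eq_sup, (atom_supPrime hp).le_finset_sup] at h3
      obtain ⟨i, hi, hpi⟩ := h3
      exact (Finset.mem_filter.1 hi).2 hpi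
    obtain ⟨s, hs, hns⟩ := hex
    obtain ⟨q, hq, h1, h2⟩ := exists_atom_sep hns
    refine ⟨fun x => q ≤ x (eT ⟨s, hs⟩), fun _ => ⟨fun x y => le_inf_iff,
      fun x y => (atom_supPrime hq).le_sup, fun i => ?_⟩⟩
    have hts : t (eT ⟨s, hs⟩) = s := by simp [t]
    simp only [hts]
    constructor
    · intro hqi
      by_contra hpi
      exact h2 (hqi.trans (Finset.le_sup' s (by simpa using hpi)))
    · intro hpi
      exact h1.trans (Finset.inf'_le s (by simpa using hpi))
  choose D hD using hD
  let h : (Fin (Fintype.card T) → L) → L :=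
    fun x => (Finset.univ.filter (fun p => IsAtom p ∧ D p x)).sup id
  have hh : ∀ p, IsAtom p → ∀ x, p ≤ h x ↔ D p x := by
    intro p hp x
    simp only [h]
    rw [(atom_supPrime hp).le_finset_sup]
    constructor
    · rintro ⟨q, hq, hpq⟩
      obtain ⟨-, hqa, hqD⟩ := Finset.mem_filter.1 hq
      have : p = q := (hqa.le_iff.1 hpq).resolve_left hp.1
      rwa [this]
    · intro hx
      exact ⟨p, by simp [hp, hx], le_rfl⟩
  have hcent : h ∈ Centralizer (LatticeClone L) _ := by
    apply mem_cent
    · intro x y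
      apply eq_of_atoms
      intro p hp
      rw [le_inf_iff, hh p hp, hh p hp, hh p hp, (hD p hp).1]
    · intro x y
      apply eq_of_atoms
      intro p hp
      rw [(atom_supPrime hp).le_sup, hh p hp, hh p hp, hh p hp, (hD p hp).2.1]
  have hmem := hT _ h hcent t htT
  convert hmem using 1
  funext i
  apply eq_of_atoms
  intro p hp
  rw [hh p hp, (hD p hp).2.2]

end Helpers

/-- a finite lattice has Property SDC for `[∧,∨]` iff it is
distributive and every element has a complement. -/
theorem stmt_13 {L : Type*} [Lattice L] [Fintype L] [Nonempty L] :
    HasSDC (LatticeClone L) ↔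
      ((∀ x y z : L, x ⊓ (y ⊔ z) = (x ⊓ y) ⊔ (x ⊓ z)) ∧
        ∀ x : L, ∃ y : L, (∀ z : L, x ⊓ y ≤ z) ∧ (∀ z : L, z ≤ x ⊔ y)) := by
  constructor
  · intro H
    letI : BoundedOrder L := Fintype.toBoundedOrder L
    refine ⟨sdc_distrib H, fun x => ?_⟩
    obtain ⟨y, h0, h1⟩ := sdc_compl H x
    exact ⟨y, fun z => h0 ▸ bot_le, fun z => h1 ▸ le_top⟩
  · rintro ⟨hd, hc⟩
    letI : DistribLattice L := DistribLattice.ofInfSupLe (fun x y z => (hd x y z).le)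
    letI : BoundedOrder L := Fintype.toBoundedOrder L
    haveI : ComplementedLattice L := ⟨fun x => by
      obtain ⟨y, h0, h1⟩ := hc x
      exact ⟨y, disjoint_iff.2 (le_bot_iff.1 (h0 ⊥)),
        codisjoint_iff.2 (top_le_iff.1 (h1 ⊤))⟩⟩
    letI : BooleanAlgebra L := DistribLattice.booleanAlgebraOfComplemented L
    exact bool_sdc (L := L)
end

section
/- Let M = (M, ∧) be a finite meet-semilattice. If M has no greatest element, then the clone C = [∧] does not have Property SDC. -/
theorem meetTerm_two {M : Type*} [SemilatticeInf M] {n : ℕ} {f : (Fin n → M) → M}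
    (hf : MeetTerm M n f) (i j : Fin n) (hij : ∀ k, k = i ∨ k = j) :
    (f = fun x => x i) ∨ (f = fun x => x j) ∨ (f = fun x => x i ⊓ x j) := by
  induction hf with
  | proj k =>
    rcases hij k with rfl | rfl
    · left; rfl
    · right; left; rfl
  | inf hf hg ihf ihg =>
    have h1 := ihf
    have h2 := ihg
    rcases h1 with rfl | rfl | rfl <;> rcases h2 with rfl | rfl | rfl <;>
      simp [inf_comm, inf_left_comm]

theorem meetTerm_zero {M : Type*} [SemilatticeInf M] {n : ℕ} {f : (Fin n → M) → M}
    (hf : MeetTerm M n f) : n ≠ 0 := by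
  induction hf with
  | proj k => rintro rfl; exact k.elim0
  | inf _ _ ih _ => exact ih

/-- if a finite meet-semilattice has no greatest element,
then the clone `[∧]` does not have Property SDC. -/
theorem stmt_14 {M : Type*} [SemilatticeInf M] [Fintype M]
    (h : ¬ ∃ t : M, ∀ x : M, x ≤ t) :
    ¬ HasSDC (MeetClone M) := by
  intro hS
  rcases isEmpty_or_nonempty M with hM | hM
  · have hc : ClosedUnder (Centralizer (MeetClone M)) (∅ : Set (Fin 0 → M)) := by
      intro m g _ t ht
      rcases m with _ | m
      · exact hM.elim (g Fin.elim0)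
      · exact (ht 0).elim
    obtain ⟨t, f, g, hf, hg, hT⟩ := (hS 0 ∅).2 hc
    have : (Fin.elim0 : Fin 0 → M) ∈ (∅ : Set (Fin 0 → M)) := by
      rw [hT]
      intro i
      exact absurd rfl (meetTerm_zero (hf i))
    exact this
  · obtain ⟨a, b, hab⟩ : ∃ a b : M, ¬ ∃ z, a ≤ z ∧ b ≤ z := by
      by_contra hcon
      push Not at hcon
      apply h
      have : IsDirectedOrder M := ⟨hcon⟩
      obtain ⟨z, hz⟩ := Finite.exists_le (fun x : M => x)
      exact ⟨z, hz⟩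
    let T : Set (Fin 2 → M) := {x | ∃ z, x 0 ≤ z ∧ x 1 ≤ z}
    have hc : ClosedUnder (Centralizer (MeetClone M)) T := by
      intro m g hg t ht
      choose z hz0 hz1 using ht
      have hmono : ∀ u v : Fin m → M, (∀ j, u j ≤ v j) → g u ≤ g v := by
        intro u v huv
        have := hg 2 (fun x => x 0 ⊓ x 1) (MeetTerm.inf (MeetTerm.proj 0) (MeetTerm.proj 1))
          ![u, v]
        have h2 : (fun j => u j ⊓ v j) = u := funext fun j => inf_eq_left.2 (huv j)
        simp [h2] at this
        exact this
      exact ⟨g z, hmono _ _ hz0, hmono _ _ hz1⟩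
    obtain ⟨t, f, g, hf, hg, hT⟩ := (hS 2 T).2 hc
    apply hab
    have key : (![a, b] : Fin 2 → M) ∈ T := by
      have h1 : (![a, a ⊓ b] : Fin 2 → M) ∈ T := ⟨a, by simp, by simp⟩
      have h2 : (![a ⊓ b, a] : Fin 2 → M) ∈ T := ⟨a, by simp, by simp⟩
      have hne : ¬ a ≤ b := fun hle => hab ⟨b, hle, le_rfl⟩
      rw [hT] at h1 h2 ⊢
      intro i
      have e1 := h1 i
      have e2 := h2 i
      have hk : ∀ k : Fin 2, k = 0 ∨ k = 1 := by decide
      rcases meetTerm_two (hf i) 0 1 hk with h3 | h3 | h3 <;>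
      rcases meetTerm_two (hg i) 0 1 hk with h4 | h4 | h4 <;>
      rw [h3, h4] at e1 e2 ⊢ <;> simp [hne] at e1 e2 
    exact key
end

section
/- Let L = (L, ∧, ∨) be a finite lattice. If L is not distributive, then the clone C = [∧] (generated by the meet operation alone) does not have Property SDC. -/
theorem meetTerm_indicator {L : Type*} [Lattice L] (tp bt : L) (hbt : bt ≤ tp) (p : L) {n : ℕ}
    {f : (Fin n → L) → L} (hf : MeetTerm L n f) (s : Fin n → L) :
    f (fun i => open Classical in if p ≤ s i then tp else bt) =
      open Classical in if p ≤ f s then tp else bt := by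
  classical
  induction hf with
  | proj i => rfl
  | inf _ _ ih1 ih2 =>
    simp only [ih1, ih2, le_inf_iff]
    split_ifs <;> simp_all

/-- if a finite lattice is not distributive, then the clone `[∧]`
does not have Property SDC. -/
theorem stmt_15 {L : Type*} [Lattice L] [Fintype L]
    (h : ¬ ∀ x y z : L, x ⊓ (y ⊔ z) = (x ⊓ y) ⊔ (x ⊓ z)) :
    ¬ HasSDC (MeetClone L) := by
  classical
  intro hS
  apply h
  intro x y z
  have : Nonempty L := ⟨x⟩
  let : BoundedOrder L := Fintype.toBoundedOrder L
  by_cases hne : (⊥ : L) = ⊤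
  · have := subsingleton_of_bot_eq_top hne
    exact Subsingleton.elim _ _
  let n := Fintype.card L
  let e : Fin n ≃ L := (Fintype.equivFin L).symm
  let t : Fin n → Fin n → L := fun j i => if e j ≤ e i then ⊤ else ⊥
  let T : Set (Fin n → L) :=
    {s | ∃ g ∈ Centralizer (MeetClone L) n, s = fun i => g (fun j => t j i)}
  have hT : ClosedUnder (Centralizer (MeetClone L)) T := by
    intro m k hk s hs
    choose g hg hgs using hs
    refine ⟨fun v => k (fun j => g j v), ?_, ?_⟩
    · intro r f hf M
      have h1 := hk r f hf (fun i j => g j (M i))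
      rw [h1]
      congr 1
      funext j
      exact hg j r f hf M
    · funext i
      congr 1
      funext j
      rw [hgs j]
  have htT : ∀ j, t j ∈ T := fun j =>
    ⟨fun v => v j, fun r f hf M => rfl, rfl⟩
  obtain ⟨r, f, g, hf, hg, hTe⟩ := (hS n T).2 hT
  have hs : (fun i => e i) ∈ T := by
    rw [hTe]
    intro i
    have key : ∀ p : L, p ≤ f i (fun i => e i) ↔ p ≤ g i (fun i => e i) := by
      intro p
      have h1 := htT (e.symm p)
      rw [hTe] at h1
      have h2 := h1 i
      have h3 := meetTerm_indicator (⊤ : L) ⊥ bot_le p (hf i) (fun i => e i)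
      have h4 := meetTerm_indicator (⊤ : L) ⊥ bot_le p (hg i) (fun i => e i)
      have h5 : t (e.symm p) = fun i => if p ≤ e i then ⊤ else ⊥ := by
        funext i; simp [t]
      rw [h5] at h2
      rw [h3, h4] at h2
      by_cases ha : p ≤ f i (fun i => e i) <;> by_cases hb : p ≤ g i (fun i => e i)
      · exact ⟨fun _ => hb, fun _ => ha⟩
      · rw [if_pos ha, if_neg hb] at h2
        exact absurd h2.symm hne
      · rw [if_neg ha, if_pos hb] at h2
        exact absurd h2 hne
      · exact ⟨fun q => absurd q ha, fun q => absurd q hb⟩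
    exact le_antisymm ((key _).1 le_rfl) ((key _).2 le_rfl)
  obtain ⟨k, hk, hke⟩ := hs
  have kinf : ∀ u v : Fin n → L, k u ⊓ k v = k (u ⊓ v) := by
    intro u v
    have := hk 2 (fun x => x 0 ⊓ x 1) (MeetTerm.inf (MeetTerm.proj 0) (MeetTerm.proj 1)) ![u, v]
    simp at this
    exact this
  have kmono : ∀ u v : Fin n → L, u ≤ v → k u ≤ k v := by
    intro u v huv
    have := kinf u v
    rw [inf_eq_left.2 huv] at this
    exact inf_eq_left.1 this
  -- downset indicators
  let d : L → Fin n → L := fun a j => if e j ≤ a then ⊤ else ⊥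
  have kd : ∀ a, k (d a) = a := by
    intro a
    have := congrFun hke (e.symm a)
    simp only [t, Equiv.apply_symm_apply] at this
    exact this.symm
  have dmono : ∀ a b, a ≤ b → d a ≤ d b := by
    intro a b hab j
    simp only [d]
    by_cases hj : e j ≤ a
    · simp [hj, hj.trans hab]
    · simp [hj]
  apply le_antisymm _ le_inf_sup
  have h1 : y ⊔ z ≤ k (d y ⊔ d z) := by
    apply sup_le
    · conv_lhs => rw [← kd y]
      exact kmono _ _ le_sup_left
    · conv_lhs => rw [← kd z]
      exact kmono _ _ le_sup_right
  calc x ⊓ (y ⊔ z) ≤ x ⊓ k (d y ⊔ d z) := inf_le_inf_left _ h1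
    _ = k (d x ⊓ (d y ⊔ d z)) := by rw [← kinf, kd]
    _ ≤ k (d ((x ⊓ y) ⊔ (x ⊓ z))) := by
        apply kmono
        intro j
        simp only [d, Pi.inf_apply, Pi.sup_apply]
        by_cases hx : e j ≤ x
        · by_cases hy : e j ≤ y
          · have : e j ≤ (x ⊓ y) ⊔ (x ⊓ z) := (le_inf hx hy).trans le_sup_left
            simp [this]
          · by_cases hz : e j ≤ z
            · have : e j ≤ (x ⊓ y) ⊔ (x ⊓ z) := (le_inf hx hz).trans le_sup_right
              simp [this]
            · simp [hy, hz]
        · simp [hx]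
    _ = _ := kd _
end

section
/- Let A be a finite set, let P be a clone on A, and suppose C is a clone on A with C* = P. If C has Property SDC, then the clone P* also has Property SDC. -/
/-- if `C* = P` and `C` has Property SDC, then `P*` has
Property SDC. -/
theorem stmt_18 {A : Type*} [Finite A] (P C : OpFamily A)
    (hP : IsClone P) (hC : IsClone C)
    (hCP : Centralizer C = P) (h : HasSDC C) :
    HasSDC (Centralizer P) := by
  have hsub : ∀ n (f : (Fin n → A) → A), f ∈ C n → f ∈ Centralizer P n := by
    intro n f hf k g hg M
    subst hCP
    exact (hg n f hf (fun i j => M j i)).symm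
  intro n T
  constructor
  · rintro ⟨t, f, g, hf, hg, rfl⟩ m u hu s hs i
    have h1 := hu n (f i) (hf i) (fun a b => s b a)
    have h2 := hu n (g i) (hg i) (fun a b => s b a)
    refine h1.trans (Eq.trans ?_ h2.symm)
    exact congrArg u (funext fun j => hs j i)
  · intro hT
    have hT' : ClosedUnder (Centralizer C) T := by
      intro m u hu
      apply hT m u
      intro k f hf M
      exact (hf m u (hCP ▸ hu) (fun i j => M j i)).symm
    obtain ⟨t, f, g, hf, hg, e⟩ := (h n T).2 hT'
    exact ⟨t, f, g, fun i => hsub _ _ (hf i), fun i => hsub _ _ (hg i), e⟩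
end
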